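/- Let Γ be a simple graph in which every clique (set of pairwise adjacent vertices) has at most n vertices. Then every finite subgroup of the right-angled Coxeter group W_Γ has order dividing 2^n. -/

import Mathlib

/-- Relations of the right-angled Coxeter group: squares of the generators and
commutators of adjacent generators. -/
def racgRels {V : Type} (Γ : SimpleGraph V) : Set (FreeGroup V) :=
  {r | ∃ s : V, r = FreeGroup.of s * FreeGroup.of s} ∪
  {r | ∃ s t : V, Γ.Adj s t ∧
    r = FreeGroup.of s * FreeGroup.of t * (FreeGroup.of s)⁻¹ * (FreeGroup.of t)⁻¹}

/-- The right-angled Coxeter group of a simple graph. -/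
abbrev RACG {V : Type} (Γ : SimpleGraph V) : Type := PresentedGroup (racgRels Γ)

namespace Monoid.PushoutI

variable {ι : Type*} {G : ι → Type*} {C : Type*} [∀ i, Group (G i)] [Group C]
  {φ : ∀ i, C →* G i}

variable (φ) in
/-- A list of letters is alternating if no letter comes from the base group and
adjacent letters come from different factors. -/
def IsAlternating (l : List (Σ i, G i)) : Prop :=
  (l.map Sigma.fst).IsChain (· ≠ ·) ∧ ∀ x ∈ l, x.2 ∉ (φ x.1).range

variable (φ) in
/-- The product in the pushout of a list of letters. -/
def listProd (l : List (Σ i, G i)) : PushoutI φ :=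
  (l.map fun x => of x.1 x.2).prod

@[simp]
theorem listProd_nil : listProd φ [] = 1 := by simp [listProd]

@[simp]
theorem listProd_cons (x : Σ i, G i) (l : List (Σ i, G i)) :
    listProd φ (x :: l) = of x.1 x.2 * listProd φ l := by simp [listProd]

@[simp]
theorem listProd_append (l l' : List (Σ i, G i)) :
    listProd φ (l ++ l') = listProd φ l * listProd φ l' := by simp [listProd]

theorem isAlternating_nil : IsAlternating φ [] := by simp [IsAlternating]

theorem isAlternating_singleton {i : ι} {a : G i} (ha : a ∉ (φ i).range) :
    IsAlternating φ [⟨i, a⟩] := by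
  simpa [IsAlternating] using ha

theorem IsAlternating.of_append_left {l l' : List (Σ i, G i)} (h : IsAlternating φ (l ++ l')) :
    IsAlternating φ l := by
  refine ⟨?_, fun x hx => h.2 x (by simp [hx])⟩
  have := h.1
  rw [List.map_append] at this
  exact this.left_of_append

theorem IsAlternating.of_append_right {l l' : List (Σ i, G i)} (h : IsAlternating φ (l ++ l')) :
    IsAlternating φ l' := by
  refine ⟨?_, fun x hx => h.2 x (by simp [hx])⟩
  have := h.1
  rw [List.map_append] at this
  exact this.right_of_append

theorem IsAlternating.append {l l' : List (Σ i, G i)} {i j : ι} {a : G i} {b : G j}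
    (h : IsAlternating φ (l ++ [⟨i, a⟩])) (h' : IsAlternating φ (⟨j, b⟩ :: l')) (hij : i ≠ j) :
    IsAlternating φ ((l ++ [⟨i, a⟩]) ++ ⟨j, b⟩ :: l') := by
  refine ⟨?_, fun x hx => ?_⟩
  · have h1 := h.1
    have h2 := h'.1
    simp only [List.map_append, List.map_cons, List.map_nil, List.append_assoc, List.cons_append,
      List.nil_append] at h1 h2 ⊢
    exact List.isChain_append_cons_cons.2 ⟨h1, hij, h2⟩
  · rcases List.mem_append.1 hx with hx | hx
    exacts [h.2 x hx, h'.2 x hx]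

theorem IsAlternating.merge {l l' : List (Σ i, G i)} {i : ι} {a b : G i}
    (h : IsAlternating φ (l ++ [⟨i, a⟩])) (h' : IsAlternating φ (⟨i, b⟩ :: l'))
    {c : G i} (hc : c ∉ (φ i).range) :
    IsAlternating φ (l ++ ⟨i, c⟩ :: l') := by
  refine ⟨?_, fun x hx => ?_⟩
  · have h1 := h.1
    have h2 := h'.1
    simp only [List.map_append, List.map_cons, List.map_nil] at h1 h2 ⊢
    exact List.isChain_split.2 ⟨h1, h2⟩
  · simp only [List.mem_append, List.mem_cons] at hx
    rcases hx with hx | rfl | hx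
    exacts [h.2 x (by simp [hx]), hc, h'.2 x (by simp [hx])]

theorem exists_eq_base_or_eq_listProd (hφ : ∀ i, Function.Injective (φ i)) (g : PushoutI φ) :
    (∃ c, g = base φ c) ∨
      ∃ i a l, IsAlternating φ (⟨i, a⟩ :: l) ∧ g = listProd φ (⟨i, a⟩ :: l) := by
  classical
  obtain ⟨d⟩ := NormalWord.transversal_nonempty φ hφ
  obtain ⟨w, rfl⟩ := (NormalWord.equiv (d := d)).symm.surjective g
  have halt : IsAlternating φ w.toList := by
    refine ⟨(List.isChain_map _).2 w.chain_ne, fun x hx hr => w.ne_one x hx ?_⟩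
    have hs := w.normalized x.1 x.2 hx
    have := (d.compl x.1).1 (a₁ := (⟨x.2, hr⟩, ⟨1, d.one_mem _⟩)) (a₂ := (1, ⟨x.2, hs⟩)) (by simp)
    simpa using congrArg (fun p => (p.1 : G x.1)) this
  have hprod : (NormalWord.equiv (d := d)).symm w = base φ w.head * listProd φ w.toList := by
    change w.prod = _
    simp only [NormalWord.prod, CoprodI.Word.prod, listProd, map_list_prod, List.map_map]
    rfl
  rw [hprod]
  rcases hw : w.toList with _ | ⟨⟨i, a⟩, l⟩
  · exact Or.inl ⟨w.head, by simp⟩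
  · rw [hw] at halt
    refine Or.inr ⟨i, φ i w.head * a, l, ?_, by simp [of_apply_eq_base, mul_assoc]⟩
    have ha : a ∉ (φ i).range := halt.2 ⟨i, a⟩ (by simp)
    refine IsAlternating.merge (l := []) (a := a) (isAlternating_singleton ha) halt ?_
    rwa [Subgroup.mul_mem_cancel_left _ (MonoidHom.mem_range.2 ⟨_, rfl⟩)]

theorem exists_length (hφ : ∀ i, Function.Injective (φ i)) :
    ∃ L : PushoutI φ → ℕ, ∀ c c' l, IsAlternating φ l →
      L (base φ c * listProd φ l * base φ c') = l.length := by
  classical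
  obtain ⟨d⟩ := NormalWord.transversal_nonempty φ hφ
  refine ⟨fun g => (NormalWord.equiv (d := d) g).toList.length, ?_⟩
  have key : ∀ c l, IsAlternating φ l →
      (NormalWord.equiv (d := d) (base φ c * listProd φ l)).toList.length = l.length := by
    intro c l hl
    let w : CoprodI.Word G := ⟨l, fun x hx h1 => hl.2 x hx (h1 ▸ one_mem _),
      (List.isChain_map _).1 hl.1⟩
    obtain ⟨w', hw', hmap⟩ := Reduced.exists_normalWord_prod_eq (φ := φ) d (w := w) hl.2
    have hprod : base φ c * listProd φ l = (c • w').prod := by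
      rw [NormalWord.prod_base_smul, hw']
      simp only [CoprodI.Word.prod, listProd, map_list_prod, List.map_map]
      rfl
    have : NormalWord.equiv (d := d) (base φ c * listProd φ l) = c • w' := by
      rw [hprod]
      exact NormalWord.equiv.apply_symm_apply _
    rw [this]
    change w'.toList.length = l.length
    simpa using congrArg List.length hmap
  intro c c' l hl
  rcases List.eq_nil_or_concat' l with rfl | ⟨l, ⟨i, a⟩, rfl⟩
  · simpa using key (c * c') [] hl
  · have ha : a ∉ (φ i).range := hl.2 ⟨i, a⟩ (by simp)
    have := key c (l ++ [⟨i, a * φ i c'⟩]) (hl.merge (isAlternating_singleton ha)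
      (by rwa [Subgroup.mul_mem_cancel_right _ (MonoidHom.mem_range.2 ⟨_, rfl⟩)]))
    simpa [of_apply_eq_base, mul_assoc] using this

/-- A subgroup of an amalgamated product all of whose elements have bounded syllable length is
conjugate into a factor. -/
theorem exists_conj_le_range_of_length_le [Nonempty ι] (hφ : ∀ i, Function.Injective (φ i))
    {L : PushoutI φ → ℕ}
    (hL : ∀ c c' l, IsAlternating φ l → L (base φ c * listProd φ l * base φ c') = l.length)
    (m : ℕ) (H : Subgroup (PushoutI φ)) (hm : ∀ h ∈ H, L h ≤ m) :
    ∃ g i, ∀ h ∈ H, g * h * g⁻¹ ∈ (of (φ := φ) i).range := by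
  have hL1 : ∀ l, IsAlternating φ l → L (listProd φ l) = l.length := fun l hl => by
    simpa using hL 1 1 l hl
  have hLof : ∀ i (x : G i), L (of i x) ≤ 1 := by
    intro i x
    by_cases hx : x ∈ (φ i).range
    · obtain ⟨c, rfl⟩ := hx
      have := hL c 1 [] isAlternating_nil
      simp only [listProd_nil, map_one, mul_one, List.length_nil] at this
      rw [of_apply_eq_base, this]
      exact Nat.zero_le _
    · simpa using (hL1 _ (isAlternating_singleton hx)).le
  induction m using Nat.strong_induction_on generalizing H with
  | _ m ih =>
  have hne : ∀ {i j a b l l'}, IsAlternating φ (l ++ [⟨i, a⟩]) → IsAlternating φ (⟨j, b⟩ :: l') →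
      listProd φ (l ++ [⟨i, a⟩]) ∈ H → listProd φ (⟨j, b⟩ :: l') ∈ H →
      m < l.length + l'.length + 2 → i = j := by
    intro i j a b l l' h1 h2 m1 m2 hlt
    by_contra hij
    have := hm _ (mul_mem m1 m2)
    rw [← listProd_append, hL1 _ (h1.append h2 hij)] at this
    simp at this
    omega
  have hmerge : ∀ {i a b l l'}, IsAlternating φ (l ++ [⟨i, a⟩]) → IsAlternating φ (⟨i, b⟩ :: l') →
      listProd φ (l ++ [⟨i, a⟩]) ∈ H → listProd φ (⟨i, b⟩ :: l') ∈ H →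
      m < l.length + l'.length + 1 → a * b ∈ (φ i).range := by
    intro i a b l l' h1 h2 m1 m2 hlt
    by_contra hab
    have h3 := hm _ (mul_mem m1 m2)
    have h4 := hL1 _ (h1.merge h2 hab)
    have h5 : listProd φ (l ++ [⟨i, a⟩]) * listProd φ (⟨i, b⟩ :: l') =
      listProd φ (l ++ ⟨i, a * b⟩ :: l') := by simp [mul_assoc]
    rw [h5, h4] at h3
    simp at h3
    omega
  rcases Nat.lt_or_ge m 2 with hm2 | hm2
  · by_cases hb : ∀ h ∈ H, ∃ c, h = base φ c
    · obtain ⟨i⟩ := ‹Nonempty ι›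
      refine ⟨1, i, fun h hh => ?_⟩
      obtain ⟨c, rfl⟩ := hb h hh
      exact ⟨φ i c, by simp [of_apply_eq_base]⟩
    · push Not at hb
      obtain ⟨h, hh, hbase⟩ := hb
      obtain ⟨c, rfl⟩ | ⟨i, a, l, hl, rfl⟩ := exists_eq_base_or_eq_listProd hφ h
      · exact absurd rfl (hbase c)
      have hlen := hm _ hh
      rw [hL1 _ hl, List.length_cons] at hlen
      obtain rfl : l = [] := List.eq_nil_of_length_eq_zero (by omega)
      refine ⟨1, i, fun k hk => ?_⟩
      obtain ⟨c, rfl⟩ | ⟨j, b, l, hl', rfl⟩ := exists_eq_base_or_eq_listProd hφ k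
      · exact ⟨φ i c, by simp [of_apply_eq_base]⟩
      have hlen := hm _ hk
      rw [hL1 _ hl', List.length_cons] at hlen
      obtain rfl : l = [] := List.eq_nil_of_length_eq_zero (by omega)
      obtain rfl := hne (l := []) hl hl' hh hk (by simp; omega)
      exact ⟨b, by simp⟩
  by_cases hlt : ∀ h ∈ H, L h ≤ m - 1
  · exact ih (m - 1) (by omega) H hlt
  push Not at hlt
  obtain ⟨h, hh, hlt⟩ := hlt
  obtain ⟨c, rfl⟩ | ⟨i₀, a₀, l₀, hl₀, rfl⟩ := exists_eq_base_or_eq_listProd hφ h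
  · have := hL c 1 [] isAlternating_nil
    simp at this
    omega
  rw [hL1 _ hl₀, List.length_cons] at hlt
  obtain ⟨l₁, ⟨i, b⟩, hl₁⟩ := (List.eq_nil_or_concat' (⟨i₀, a₀⟩ :: l₀)).resolve_left (by simp)
  have halt := hl₀
  have hmem := hh
  rw [hl₁] at halt hmem
  have hlen : l₀.length = l₁.length := by simpa using congrArg List.length hl₁
  obtain rfl := hne halt hl₀ hmem hh (by omega)
  have hba := hmerge halt hl₀ hmem hh (by omega)
  have hconj : ∀ h ∈ H, L (of i b * h * (of i b)⁻¹) ≤ m - 1 := by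
    intro k hk
    have hle := hm k hk
    obtain ⟨c, rfl⟩ | ⟨j, a, l, hl, rfl⟩ := exists_eq_base_or_eq_listProd hφ k
    · rw [← of_apply_eq_base φ i c, ← map_inv, ← map_mul, ← map_mul]
      exact (hLof _ _).trans (by omega)
    rw [hL1 _ hl, List.length_cons] at hle
    obtain rfl := hne halt hl hmem hk (by omega)
    rcases List.eq_nil_or_concat' l with rfl | ⟨l, ⟨j, b'⟩, rfl⟩
    · rw [listProd_cons, listProd_nil, mul_one, ← map_inv, ← map_mul, ← map_mul]
      exact (hLof _ _).trans (by omega)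
    obtain ⟨c, hc⟩ := hmerge halt hl hmem hk (by simp; omega)
    rw [← List.cons_append] at hl hk
    obtain rfl := hne hl hl₀ hk hh (by simp; omega)
    have hb'a := hmerge hl hl₀ hk hh (by simp; omega)
    obtain ⟨c', hc'⟩ : b' * b⁻¹ ∈ (φ j).range := by
      simpa [mul_assoc] using mul_mem hb'a (inv_mem hba)
    have heq : of j b * listProd φ (⟨j, a⟩ :: (l ++ [⟨j, b'⟩])) * (of j b)⁻¹ =
        base φ c * listProd φ l * base φ c' := by
      rw [← of_apply_eq_base φ j c, ← of_apply_eq_base φ j c', hc, hc']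
      simp [mul_assoc]
    have hl' : IsAlternating φ l :=
      IsAlternating.of_append_right (l := [⟨j, a⟩]) (IsAlternating.of_append_left hl)
    rw [heq, hL _ _ _ hl']
    simp at hle
    omega
  obtain ⟨g, j, hg⟩ := ih (m - 1) (by omega) (H.map (MulAut.conj (of i b)).toMonoidHom) (by
    rintro _ ⟨h, hh, rfl⟩
    exact hconj h hh)
  refine ⟨g * of i b, j, fun h hh => ?_⟩
  simpa [mul_assoc] using hg _ ⟨h, hh, rfl⟩

/-- A finite subgroup of an amalgamated product is conjugate into a factor. -/
theorem exists_conj_le_range_of_finite [Nonempty ι] (hφ : ∀ i, Function.Injective (φ i))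
    (H : Subgroup (PushoutI φ)) [Finite H] :
    ∃ g i, ∀ h ∈ H, g * h * g⁻¹ ∈ (of (φ := φ) i).range := by
  obtain ⟨L, hL⟩ := exists_length hφ
  obtain ⟨m, hm⟩ := (Set.toFinite (L '' (H : Set (PushoutI φ)))).bddAbove
  exact exists_conj_le_range_of_length_le hφ hL m H fun h hh => hm ⟨h, hh, rfl⟩

end Monoid.PushoutI

namespace RACG

variable {V V' : Type} {Γ : SimpleGraph V} {Γ' : SimpleGraph V'} {G : Type*} [Group G]

/-- The generator of the right-angled Coxeter group at a vertex. -/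
def of (Γ : SimpleGraph V) (s : V) : RACG Γ := PresentedGroup.of s

theorem of_mul_self (s : V) : of Γ s * of Γ s = 1 :=
  PresentedGroup.one_of_mem (rels := racgRels Γ) (Or.inl ⟨s, rfl⟩)

theorem commute_of {s t : V} (h : Γ.Adj s t) : Commute (of Γ s) (of Γ t) := by
  have : of Γ s * of Γ t * (of Γ s)⁻¹ * (of Γ t)⁻¹ = 1 :=
    PresentedGroup.one_of_mem (rels := racgRels Γ) (Or.inr ⟨s, t, h, rfl⟩)
  exact (mul_inv_eq_iff_eq_mul.1 (mul_inv_eq_one.1 this))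

/-- The universal property of the right-angled Coxeter group. -/
def lift (f : V → G) (hsq : ∀ s, f s * f s = 1) (hcomm : ∀ s t, Γ.Adj s t → Commute (f s) (f t)) :
    RACG Γ →* G :=
  PresentedGroup.toGroup (f := f) (by
    rintro r (⟨s, rfl⟩ | ⟨s, t, h, rfl⟩)
    · simpa using hsq s
    · simp [(hcomm s t h).eq])

@[simp]
theorem lift_of (f : V → G) (hsq hcomm) (s : V) : lift (Γ := Γ) f hsq hcomm (of Γ s) = f s :=
  PresentedGroup.toGroup.of _

theorem hom_ext {f g : RACG Γ →* G} (h : ∀ s, f (of Γ s) = g (of Γ s)) : f = g :=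
  PresentedGroup.ext h

/-- The homomorphism of right-angled Coxeter groups induced by an embedding of graphs. -/
def map (e : Γ' ↪g Γ) : RACG Γ' →* RACG Γ :=
  lift (fun s => of Γ (e s)) (fun _ => of_mul_self _) fun _ _ h => commute_of (e.map_adj_iff.2 h)

@[simp]
theorem map_of (e : Γ' ↪g Γ) (s : V') : map e (of Γ' s) = of Γ (e s) := lift_of _ _ _ _

theorem map_injective (e : Γ' ↪g Γ) : Function.Injective (map e) := by
  classical
  let f : V → RACG Γ' := fun s => if h : ∃ t, e t = s then of Γ' h.choose else 1
  have hf : ∀ t, f (e t) = of Γ' t := fun t => by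
    have h : ∃ t', e t' = e t := ⟨t, rfl⟩
    simp only [f, dif_pos h]
    rw [e.injective h.choose_spec]
  have hf' : ∀ s, (∃ t, e t = s) ∨ f s = 1 := fun s => by
    by_cases h : ∃ t, e t = s
    · exact Or.inl h
    · exact Or.inr (dif_neg h)
  let r : RACG Γ →* RACG Γ' := lift f
    (fun s => by
      obtain ⟨t, rfl⟩ | h := hf' s
      · rw [hf, of_mul_self]
      · rw [h, one_mul])
    (fun s t hst => by
      obtain ⟨s, rfl⟩ | h := hf' s
      · obtain ⟨t, rfl⟩ | h := hf' t
        · rw [hf, hf]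
          exact commute_of (e.map_adj_iff.1 hst)
        · rw [h]
          exact Commute.one_right _
      · rw [h]
        exact Commute.one_left _)
  have hr : r.comp (map e) = MonoidHom.id _ := hom_ext fun s => by simp [r, hf]
  exact Function.LeftInverse.injective (g := r) fun x => DFunLike.congr_fun hr x

theorem closure_range_of : Subgroup.closure (Set.range (of Γ)) = ⊤ :=
  PresentedGroup.closure_range_of _

theorem exists_finset_mem_range (x : RACG Γ) :
    ∃ S : Finset V, ∀ T : Set V, ↑S ⊆ T →
      x ∈ (map (SimpleGraph.Embedding.induce (G := Γ) T)).range := by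
  classical
  have hx : x ∈ Subgroup.closure (Set.range (of Γ)) := by simp [closure_range_of]
  induction hx using Subgroup.closure_induction with
  | mem x hx =>
    obtain ⟨s, rfl⟩ := hx
    exact ⟨{s}, fun T hT => ⟨of _ ⟨s, hT (by simp)⟩, by simp⟩⟩
  | one => exact ⟨∅, fun T _ => one_mem _⟩
  | mul x y _ _ hx hy =>
    obtain ⟨S, hS⟩ := hx
    obtain ⟨S', hS'⟩ := hy
    refine ⟨S ∪ S', fun T hT => mul_mem (hS T ?_) (hS' T ?_)⟩
    · exact (Finset.coe_subset.2 Finset.subset_union_left).trans hT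
    · exact (Finset.coe_subset.2 Finset.subset_union_right).trans hT
  | inv x _ hx =>
    obtain ⟨S, hS⟩ := hx
    exact ⟨S, fun T hT => inv_mem (hS T hT)⟩

theorem card_dvd_of_top [Finite V] (h : ∀ s t, s ≠ t → Γ.Adj s t) :
    Nat.card (RACG Γ) ∣ 2 ^ Nat.card V := by
  classical
  have := Fintype.ofFinite V
  let f : (∀ s : V, Subgroup.zpowers (of Γ s)) →* RACG Γ :=
    Subgroup.noncommPiCoprod (H := fun s => Subgroup.zpowers (of Γ s)) (by
      rintro s t hst _ _ ⟨k, rfl⟩ ⟨l, rfl⟩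
      exact (commute_of (h s t hst)).zpow_zpow k l)
  have hf : Function.Surjective f := by
    rw [← MonoidHom.range_eq_top, eq_top_iff, ← closure_range_of, Subgroup.closure_le]
    rintro _ ⟨s, rfl⟩
    exact ⟨Pi.mulSingle s ⟨_, Subgroup.mem_zpowers _⟩, Subgroup.noncommPiCoprod_mulSingle _ _⟩
  refine (Subgroup.card_dvd_of_surjective f hf).trans ?_
  rw [Nat.card_pi, Nat.card_eq_fintype_card, ← Finset.card_univ, ← Finset.prod_const]
  refine Finset.prod_dvd_prod_of_dvd _ _ fun s _ => ?_
  rw [Nat.card_zpowers]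
  exact orderOf_dvd_of_pow_eq_one (by rw [pow_two, of_mul_self])

/-- The right-angled Coxeter group splits as an amalgam along any pair of distinct non-adjacent
vertices, so a finite subgroup is isomorphic to one of the group of the graph with one of these
vertices removed; only the equality of orders is stated. -/
theorem exists_card_eq_of_not_adj (u : Bool → V) (hne : u true ≠ u false)
    (hadj : ¬ Γ.Adj (u true) (u false)) (H : Subgroup (RACG Γ)) [Finite H] :
    ∃ (b : Bool) (K : Subgroup (RACG (Γ.induce {x | x ≠ u b}))),
      Nat.card H = Nat.card K := by
  classical
  let e : ∀ b, Γ.induce {x | ∀ b, x ≠ u b} ↪g Γ.induce {x | x ≠ u b} := fun b =>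
    SimpleGraph.induceHomOfLE Γ (fun x hx => hx b)
  let φ : ∀ b, RACG (Γ.induce {x | ∀ b, x ≠ u b}) →* RACG (Γ.induce {x | x ≠ u b}) :=
    fun b => map (e b)
  have hφ : ∀ b, Function.Injective (φ b) := fun b => map_injective (e b)
  let P := Monoid.PushoutI φ
  let f : V → P := fun x =>
    if h : x ≠ u true then Monoid.PushoutI.of true (of _ ⟨x, h⟩)
    else Monoid.PushoutI.of false (of _ ⟨x, fun h' => hne ((not_not.1 h).symm.trans h')⟩)
  have hf : ∀ b x (h : x ≠ u b), f x = Monoid.PushoutI.of b (of _ ⟨x, h⟩) := by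
    intro b x h
    cases b
    · by_cases h' : x ≠ u true
      · have hx : ∀ b, x ≠ u b := fun b => by cases b <;> assumption
        have key : ∀ b, Monoid.PushoutI.of (φ := φ) b (of _ ⟨x, hx b⟩) =
            Monoid.PushoutI.base φ (of _ ⟨x, hx⟩) := fun b => by
          rw [← Monoid.PushoutI.of_apply_eq_base φ b]
          simp only [φ, map_of]
          rfl
        simp only [f, dif_pos h']
        exact (key true).trans (key false).symm
      · simp only [f, dif_neg h']
    · simp only [f, dif_pos h]
  have hor : ∀ x y, Γ.Adj x y ∨ x = y → ∃ b, x ≠ u b ∧ y ≠ u b := by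
    intro x y hxy
    by_contra! hcon
    have h1 := hcon true
    have h2 := hcon false
    rcases hxy with hxy | rfl
    · by_cases hx : x = u true
      · have hy := h2 (hx ▸ hne)
        exact hadj (hx ▸ hy ▸ hxy)
      · have hy := h1 hx
        by_cases hx' : x = u false
        · exact hadj (hx' ▸ hy ▸ hxy.symm)
        · exact hne (hy.symm.trans (h2 hx'))
    · by_cases hx : x = u true
      · exact hne (hx.symm.trans (h2 (hx ▸ hne)))
      · exact hx (h1 hx)
  let F : RACG Γ →* P := lift f
    (fun s => by
      obtain ⟨b, hb, -⟩ := hor s s (Or.inr rfl)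
      rw [hf b s hb, ← map_mul, of_mul_self, map_one])
    (fun s t hst => by
      obtain ⟨b, hs, ht⟩ := hor s t (Or.inl hst)
      rw [hf b s hs, hf b t ht]
      exact (commute_of (Γ := Γ.induce {x | x ≠ u b}) (s := ⟨s, hs⟩) (t := ⟨t, ht⟩) hst).map _)
  let R : P →* RACG Γ := Monoid.PushoutI.lift
    (fun b => map (SimpleGraph.Embedding.induce {x | x ≠ u b}))
    (map (SimpleGraph.Embedding.induce {x | ∀ b, x ≠ u b}))
    (fun b => hom_ext fun s => by
      simp only [φ, MonoidHom.comp_apply, map_of]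
      rfl)
  have hRF : R.comp F = MonoidHom.id _ := hom_ext fun s => by
    obtain ⟨b, hb, -⟩ := hor s s (Or.inr rfl)
    simp only [MonoidHom.comp_apply, F, lift_of, MonoidHom.id_apply]
    rw [hf b s hb]
    rfl
  have hF : Function.Injective F :=
    Function.LeftInverse.injective (g := R) fun x => DFunLike.congr_fun hRF x
  have : Finite (H.map F) := inferInstanceAs (Finite (F '' (H : Set (RACG Γ))))
  obtain ⟨g, b, hg⟩ := Monoid.PushoutI.exists_conj_le_range_of_finite hφ (H.map F)
  let Φ : RACG Γ →* P := (MulAut.conj g).toMonoidHom.comp F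
  have hΦ : Function.Injective Φ := (MulAut.conj g).injective.comp hF
  have hle : H.map Φ ≤ (Monoid.PushoutI.of (φ := φ) b).range := by
    rintro _ ⟨h, hh, rfl⟩
    exact hg _ ⟨h, hh, rfl⟩
  refine ⟨b, (H.map Φ).comap (Monoid.PushoutI.of (φ := φ) b), ?_⟩
  rw [← Subgroup.card_map_of_injective hΦ,
    ← Subgroup.card_map_of_injective (Monoid.PushoutI.of_injective hφ b),
    Subgroup.map_comap_eq_self hle]

theorem card_le_of_isClique_of_embedding {n : ℕ}
    (hclique : ∀ s : Finset V, Γ.IsClique (s : Set V) → s.card ≤ n) (e : Γ' ↪g Γ)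
    (s : Finset V') (hs : Γ'.IsClique (s : Set V')) : s.card ≤ n := by
  rw [← Finset.card_map e.toEmbedding]
  refine hclique _ ?_
  rw [Finset.coe_map]
  rintro _ ⟨x, hx, rfl⟩ _ ⟨y, hy, rfl⟩ hxy
  exact e.map_adj_iff.2 (hs hx hy fun h => hxy (h ▸ rfl))

theorem card_subgroup_dvd_of_finite (k n : ℕ) {V : Type} [Finite V] (hV : Nat.card V = k)
    (Γ : SimpleGraph V) (hclique : ∀ s : Finset V, Γ.IsClique (s : Set V) → s.card ≤ n)
    (H : Subgroup (RACG Γ)) [Finite H] : Nat.card H ∣ 2 ^ n := by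
  induction k using Nat.strong_induction_on generalizing V with
  | _ k ih =>
  by_cases htop : ∀ s t, s ≠ t → Γ.Adj s t
  · have := Fintype.ofFinite V
    have hle := hclique Finset.univ fun s _ t _ h => htop s t h
    rw [Finset.card_univ, ← Nat.card_eq_fintype_card] at hle
    exact (Subgroup.card_subgroup_dvd_card H).trans
      ((card_dvd_of_top htop).trans (pow_dvd_pow 2 hle))
  · push Not at htop
    obtain ⟨s, t, hst, hadj⟩ := htop
    obtain ⟨b, K, hK⟩ :=
      exists_card_eq_of_not_adj (fun b => bif b then s else t) hst hadj H
    have : Finite K := Nat.finite_of_card_ne_zero (hK ▸ Nat.card_pos.ne')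
    rw [hK]
    refine ih _ ?_ rfl _ (card_le_of_isClique_of_embedding hclique
      (SimpleGraph.Embedding.induce _)) K
    rw [← hV]
    exact Finite.card_subtype_lt (x := bif b then s else t) (by simp)

end RACG

/-- if every clique of `Γ` has at most `n` vertices, then every
finite subgroup of the right-angled Coxeter group `W_Γ` has order dividing `2^n`. -/
theorem racg_finite_subgroup_order_dvd {V : Type} (Γ : SimpleGraph V) (n : ℕ)
    (hclique : ∀ s : Finset V, Γ.IsClique (s : Set V) → s.card ≤ n)
    (H : Subgroup (RACG Γ)) (hH : Finite H) :
    Nat.card H ∣ 2 ^ n := by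
  classical
  have := Fintype.ofFinite H
  choose S hS using fun x : RACG Γ => RACG.exists_finset_mem_range x
  let T : Finset V := Finset.univ.biUnion fun h : H => S h
  let e : Γ.induce (T : Set V) ↪g Γ := SimpleGraph.Embedding.induce (T : Set V)
  have hle : H ≤ (RACG.map e).range := fun h hh => hS h _ (Finset.coe_subset.2
    (Finset.subset_biUnion_of_mem (fun h : H => S h) (Finset.mem_univ ⟨h, hh⟩)))
  have hcard : Nat.card H = Nat.card (H.comap (RACG.map e)) := by
    rw [← Subgroup.card_map_of_injective (RACG.map_injective e), Subgroup.map_comap_eq_self hle]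
  have : Finite (H.comap (RACG.map e)) :=
    Nat.finite_of_card_ne_zero (hcard ▸ Nat.card_pos.ne')
  rw [hcard]
  exact RACG.card_subgroup_dvd_of_finite _ n rfl _
    (RACG.card_le_of_isClique_of_embedding hclique e) _
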